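/- arXiv:1503.04408 — 2 statements merged into one kernel-verified Lean document; each statement's English description precedes it below -/
import Mathlib

section
/- Let G be a general skew-symmetric 2k×2k matrix of linear forms in four variables over ℂ, and let I be the ideal of R = ℂ[x1,x2,x3,x4] generated by the submaximal (2k−2)×(2k−2) Pfaffians of G. Then for every general linear form L, the multiplication-by-L map (R/I)_{d−1} → (R/I)_d is surjective for all d ≥ k. -/
open MvPolynomial

/-- The Pfaffian of a `2n × 2n` matrix of multivariate polynomials over `ℂ`,
given by the standard averaged signed sum over permutations. -/
noncomputable def pfaff {σ : Type*} {n : ℕ}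
    (M : Matrix (Fin (2*n)) (Fin (2*n)) (MvPolynomial σ ℂ)) : MvPolynomial σ ℂ :=
  (((2^n * n.factorial : ℕ) : ℂ)⁻¹) •
    ∑ p : Equiv.Perm (Fin (2*n)),
      (Equiv.Perm.sign p : ℤ) •
        ∏ i : Fin n, M (p ⟨2*i.1, by have := i.2; omega⟩) (p ⟨2*i.1+1, by have := i.2; omega⟩)

/-- A square matrix of polynomials is skew-symmetric. -/
def IsSkew {m : Type*} {R : Type*} [Ring R] (M : Matrix m m R) : Prop :=
  ∀ i j, M j i = - M i j

/-- A square integer matrix is homogeneous. -/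
def HomogMat {m : Type*} (A : Matrix m m ℕ) : Prop :=
  ∀ i j l r, A i j + A l r = A i r + A l j

/-- A matrix of polynomials has degree matrix `A`. -/
def DegMat {σ m : Type*} (M : Matrix m m (MvPolynomial σ ℂ)) (A : Matrix m m ℕ) : Prop :=
  ∀ i j, (M i j).IsHomogeneous (A i j)

/-- The set of submaximal Pfaffians of a skew-symmetric matrix of even size `2k`:
Pfaffians of the submatrices obtained by erasing two rows and the two columns
with the same indexes. -/
def submaxPfEven {σ : Type*} {k : ℕ}
    (M : Matrix (Fin (2*k)) (Fin (2*k)) (MvPolynomial σ ℂ)) : Set (MvPolynomial σ ℂ) :=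
  { q | ∃ e : Fin (2*(k-1)) ↪o Fin (2*k), q = pfaff (M.submatrix e e) }

/-- The set of submaximal Pfaffians of a skew-symmetric matrix of odd size `2k-1`:
Pfaffians of the submatrices obtained by erasing one row and the column
with the same index. -/
def submaxPfOdd {σ : Type*} {k : ℕ}
    (M : Matrix (Fin (2*k-1)) (Fin (2*k-1)) (MvPolynomial σ ℂ)) : Set (MvPolynomial σ ℂ) :=
  { q | ∃ e : Fin (2*(k-1)) ↪o Fin (2*k-1), q = pfaff (M.submatrix e e) }

/-! ### Pfaffians of tridiagonal skew-symmetric matrices -/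

/-- The identification of `Fin n × Fin 2` with `Fin (2 * n)` sending `(i, b)` to `2 * i + b`. -/
def pairEquiv (n : ℕ) : Fin n × Fin 2 ≃ Fin (2 * n) :=
  finProdFinEquiv.trans (finCongr (mul_comm n 2))

lemma pairEquiv_val {n : ℕ} (x : Fin n × Fin 2) : (pairEquiv n x : ℕ) = 2 * x.1 + x.2 := by
  simp [pairEquiv, add_comm]

/-- A perfect matching of a path by edges of the path pairs `2 * m` with `2 * m + 1`. -/
lemma path_matching {n : ℕ} (f : ℕ → ℕ)
    (hinv : ∀ v < 2 * n, f (f v) = v) (hadj : ∀ v < 2 * n, f v = v + 1 ∨ v = f v + 1) :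
    ∀ m < n, f (2 * m) = 2 * m + 1 := by
  intro m
  induction m with
  | zero => intro h; simpa using (hadj 0 (by omega)).resolve_right (by omega)
  | succ m ih =>
    intro h
    have h1 := ih (by omega)
    rcases hadj (2 * (m + 1)) (by omega) with h2 | h2
    · exact h2
    · have h3 := hinv (2 * (m + 1)) (by omega)
      have h4 := hinv (2 * m) (by omega)
      rw [show f (2 * (m + 1)) = 2 * m + 1 by omega] at h3
      rw [h1] at h4
      omega

/-- A permutation of `Fin n × Fin 2` commuting with the flip of the second coordinate permutes
the blocks and flips some of them. -/
lemma exists_eq_of_comm_flip {n : ℕ} (p : Equiv.Perm (Fin n × Fin 2))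
    (h0 : ∀ i, p (i, 1) = ((p (i, 0)).1, (p (i, 0)).2 + 1)) :
    ∃ (s : Equiv.Perm (Fin n)) (t : Fin n → Fin 2),
      p = Equiv.prodCongrLeft (fun _ => s) * Equiv.prodCongrRight (fun i => Equiv.addRight (t i)) := by
  have hinj : Function.Injective fun i => (p (i, 0)).1 := by
    intro i j hij
    dsimp only at hij
    by_cases h : (p (i, 0)).2 = (p (j, 0)).2
    · have := p.injective (Prod.ext hij h)
      exact congrArg Prod.fst this
    · have h2 : (p (j, 0)).2 = (p (i, 0)).2 + 1 := by
        generalize (p (i, 0)).2 = a at *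
        generalize (p (j, 0)).2 = b at *
        revert h; revert a b; decide
      have h3 : p (j, 0) = p (i, 1) := by rw [h0]; exact Prod.ext hij.symm h2
      exact (congrArg Prod.fst (p.injective h3)).symm
  refine ⟨Equiv.ofBijective _ hinj.bijective_of_finite, fun i => (p (i, 0)).2, ?_⟩
  ext1 ⟨i, b⟩
  rcases Fin.exists_fin_two.1 ⟨b, rfl⟩ with rfl | rfl
  · simp
  · simp [h0, add_comm]

lemma sign_block_perm {n : ℕ} (s : Equiv.Perm (Fin n)) (t : Fin n → Fin 2) :
    Equiv.Perm.sign (Equiv.prodCongrLeft (fun _ : Fin 2 => s) *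
      Equiv.prodCongrRight (fun i => Equiv.addRight (t i))) =
      ∏ i, Equiv.Perm.sign (Equiv.addRight (t i)) := by
  rw [map_mul, Equiv.Perm.sign_prodCongrLeft, Equiv.Perm.sign_prodCongrRight]
  simp

lemma pfaff_term_of_tridiagonal {σ : Type*} {n : ℕ}
    (M : Matrix (Fin (2 * n)) (Fin (2 * n)) (MvPolynomial σ ℂ)) (hM : IsSkew M)
    (h0 : ∀ u v : Fin (2 * n), M u v ≠ 0 → (u : ℕ) + 1 = v ∨ (v : ℕ) + 1 = u)
    (p : Equiv.Perm (Fin (2 * n)))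
    (hp : ∏ i, M (p (pairEquiv n (i, 0))) (p (pairEquiv n (i, 1))) ≠ 0) :
    (Equiv.Perm.sign p : ℤ) • ∏ i, M (p (pairEquiv n (i, 0))) (p (pairEquiv n (i, 1))) =
      ∏ i, M (pairEquiv n (i, 0)) (pairEquiv n (i, 1)) := by
  set q : Equiv.Perm (Fin n × Fin 2) := (pairEquiv n).symm.permCongr p with hq
  have hpq : ∀ x, p (pairEquiv n x) = pairEquiv n (q x) := by intro x; simp [hq]
  have hsign : Equiv.Perm.sign p = Equiv.Perm.sign q := by simp [hq]
  simp only [hpq] at hp ⊢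
  rw [hsign]
  have hadj : ∀ i, (pairEquiv n (q (i, 0)) : ℕ) + 1 = pairEquiv n (q (i, 1)) ∨
      (pairEquiv n (q (i, 1)) : ℕ) + 1 = pairEquiv n (q (i, 0)) :=
    fun i => h0 _ _ (Finset.prod_ne_zero_iff.1 hp i (Finset.mem_univ i))
  have hcomm : ∀ i, q (i, 1) = ((q (i, 0)).1, (q (i, 0)).2 + 1) := by
    let g : Fin (2 * n) → Fin (2 * n) := fun v =>
      pairEquiv n (q ((q.symm ((pairEquiv n).symm v)).1, (q.symm ((pairEquiv n).symm v)).2 + 1))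
    have hg : ∀ i b, g (pairEquiv n (q (i, b))) = pairEquiv n (q (i, b + 1)) := by
      intro i b; simp [g]
    have hsurj : ∀ v, ∃ i b, v = pairEquiv n (q (i, b)) := fun v =>
      ⟨(q.symm ((pairEquiv n).symm v)).1, (q.symm ((pairEquiv n).symm v)).2, by simp⟩
    clear_value g
    have hgg : ∀ v, g (g v) = v := by
      intro v
      obtain ⟨i, b, rfl⟩ := hsurj v
      rw [hg, hg, add_assoc]
      simp
    have hga : ∀ v, (g v : ℕ) = v + 1 ∨ (v : ℕ) = g v + 1 := by
      intro v
      obtain ⟨i, b, rfl⟩ := hsurj v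
      rw [hg]
      have := hadj i
      rcases Fin.exists_fin_two.1 ⟨b, rfl⟩ with rfl | rfl
      · rw [zero_add]; omega
      · rw [show (1 : Fin 2) + 1 = 0 from rfl]; omega
    have key : ∀ m : Fin n, g (pairEquiv n (m, 0)) = pairEquiv n (m, 1) := by
      intro m
      have := path_matching (n := n) (fun v => if h : v < 2 * n then g ⟨v, h⟩ else 0)
        (fun v hv => by simp [hv, hgg])
        (fun v hv => by simpa [hv] using hga ⟨v, hv⟩) m m.2
      have hm : 2 * (m : ℕ) < 2 * n := by omega
      simp only [hm, dif_pos] at this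
      apply Fin.ext
      rw [pairEquiv_val, show pairEquiv n (m, 0) = ⟨2 * m, hm⟩ from Fin.ext (by simp [pairEquiv_val])]
      simpa using this
    have key' : ∀ x : Fin n × Fin 2, g (pairEquiv n x) = pairEquiv n (x.1, x.2 + 1) := by
      rintro ⟨m, b⟩
      rcases Fin.exists_fin_two.1 ⟨b, rfl⟩ with rfl | rfl
      · simpa using key m
      · rw [← key m, hgg]; rfl
    intro i
    apply (pairEquiv n).injective
    rw [← key', hg, zero_add]
  obtain ⟨s, t, hst⟩ := exists_eq_of_comm_flip q hcomm
  rw [hst, sign_block_perm]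
  rw [← Equiv.prod_comp s fun i => M (pairEquiv n (i, 0)) (pairEquiv n (i, 1))]
  have : ∀ u : Fin 2, ∀ i : Fin n,
      ((Equiv.Perm.sign (Equiv.addRight u) : ℤˣ) : ℤ) •
        M (pairEquiv n (i, 0 + u)) (pairEquiv n (i, 1 + u)) =
      M (pairEquiv n (i, 0)) (pairEquiv n (i, 1)) := by
    intro u i
    rcases Fin.exists_fin_two.1 ⟨u, rfl⟩ with rfl | rfl
    · simp
    · rw [show Equiv.Perm.sign (Equiv.addRight (1 : Fin 2)) = -1 by decide,
        show (1 : Fin 2) + 1 = 0 from rfl, zero_add, hM (pairEquiv n (i, 0))]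
      simp
  rw [Units.coe_prod, Finset.prod_congr rfl fun i _ => (this (t i) (s i)).symm]
  simp [zsmul_eq_mul, Finset.prod_mul_distrib]

/-- Up to a nonzero scalar, the Pfaffian of a tridiagonal skew-symmetric matrix is the product of
every other entry above the diagonal. -/
lemma exists_smul_pfaff_of_tridiagonal {σ : Type*} {n : ℕ}
    (M : Matrix (Fin (2 * n)) (Fin (2 * n)) (MvPolynomial σ ℂ)) (hM : IsSkew M)
    (h0 : ∀ u v : Fin (2 * n), M u v ≠ 0 → (u : ℕ) + 1 = v ∨ (v : ℕ) + 1 = u) :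
    ∃ c : ℂ, c • pfaff M = ∏ i, M (pairEquiv n (i, 0)) (pairEquiv n (i, 1)) := by
  classical
  set Z := ∏ i, M (pairEquiv n (i, 0)) (pairEquiv n (i, 1)) with hZ
  let T : Equiv.Perm (Fin (2 * n)) → MvPolynomial σ ℂ :=
    fun p => ∏ i, M (p (pairEquiv n (i, 0))) (p (pairEquiv n (i, 1)))
  have hpf : pfaff M = (((2 ^ n * n.factorial : ℕ) : ℂ)⁻¹) •
      ∑ p, (Equiv.Perm.sign p : ℤ) • T p := by
    unfold pfaff
    congr! with p _ i _
    all_goals simp [pairEquiv_val]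
  have hsum : ∑ p, (Equiv.Perm.sign p : ℤ) • T p =
      (((Finset.univ.filter fun p => T p ≠ 0).card : ℕ) : ℂ) • Z := by
    rw [← Finset.sum_filter_of_ne (p := fun p => T p ≠ 0) fun p _ h h' => h (by rw [h', smul_zero]),
      Finset.sum_congr rfl fun p hp =>
        pfaff_term_of_tridiagonal M hM h0 p (Finset.mem_filter.1 hp).2]
    rw [Finset.sum_const, Nat.cast_smul_eq_nsmul]
  by_cases hZ0 : Z = 0
  · exact ⟨0, by rw [hZ0, zero_smul]⟩
  have hcard : (Finset.univ.filter fun p => T p ≠ 0).card ≠ 0 :=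
    Finset.card_ne_zero_of_mem (a := 1) (Finset.mem_filter.2 ⟨Finset.mem_univ _, hZ0⟩)
  have h2 : (((2 ^ n * n.factorial : ℕ) : ℂ)⁻¹) *
      (((Finset.univ.filter fun p => T p ≠ 0).card : ℕ) : ℂ) ≠ 0 :=
    mul_ne_zero (inv_ne_zero (by exact_mod_cast by positivity)) (by exact_mod_cast hcard)
  refine ⟨((((2 ^ n * n.factorial : ℕ) : ℂ)⁻¹) *
      (((Finset.univ.filter fun p => T p ≠ 0).card : ℕ) : ℂ))⁻¹, ?_⟩
  rw [hpf, hsum, smul_smul, smul_smul, mul_assoc, inv_mul_cancel₀ h2, one_smul]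

/-! ### Polynomial functions -/

/-- The algebra of functions that are polynomial in the coordinates `c`. -/
noncomputable def polyFun {X T : Type*} (c : X → T → ℂ) : Subalgebra ℂ (X → ℂ) :=
  (AlgHom.pi fun x : X => aeval (R := ℂ) (c x)).range

lemma mem_polyFun_iff {X T : Type*} {c : X → T → ℂ} {f : X → ℂ} :
    f ∈ polyFun c ↔ ∃ P : MvPolynomial T ℂ, ∀ x, eval (c x) P = f x := by
  simp [polyFun, AlgHom.mem_range, funext_iff]

lemma coord_mem_polyFun {X T : Type*} (c : X → T → ℂ) (t : T) :
    (fun x => c x t) ∈ polyFun c :=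
  mem_polyFun_iff.2 ⟨MvPolynomial.X t, fun x => by simp⟩

/-- The algebra of polynomial-valued functions all of whose coefficients lie in `A`. -/
noncomputable def coeffwise {X : Type*} (σ : Type*) (A : Subalgebra ℂ (X → ℂ)) :
    Subalgebra ℂ (X → MvPolynomial σ ℂ) where
  carrier := {h | ∀ m, (fun x => coeff m (h x)) ∈ A}
  add_mem' {a b} ha hb m := by
    have : (fun x => coeff m ((a + b) x)) = (fun x => coeff m (a x)) + fun x => coeff m (b x) := by
      ext x
      simp
    rw [this]
    exact A.add_mem (ha m) (hb m)
  mul_mem' {a b} ha hb m := by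
    classical
    have : (fun x => coeff m ((a * b) x)) =
        ∑ y ∈ Finset.HasAntidiagonal.antidiagonal m, (fun x => coeff y.1 (a x)) * fun x => coeff y.2 (b x) := by
      ext x
      simp [coeff_mul]
    rw [this]
    exact A.sum_mem fun y _ => A.mul_mem (ha _) (hb _)
  algebraMap_mem' r m := by
    exact A.algebraMap_mem (coeff m (algebraMap ℂ (MvPolynomial σ ℂ) r))

lemma const_mem_coeffwise {X σ : Type*} (A : Subalgebra ℂ (X → ℂ)) (f : MvPolynomial σ ℂ) :
    (fun _ => f) ∈ coeffwise σ A :=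
  fun m => A.algebraMap_mem (coeff m f)

lemma pfaff_mem_coeffwise {X σ : Type*} {n : ℕ} {A : Subalgebra ℂ (X → ℂ)}
    {M : X → Matrix (Fin (2 * n)) (Fin (2 * n)) (MvPolynomial σ ℂ)}
    (hM : ∀ r s, (fun x => M x r s) ∈ coeffwise σ A) :
    (fun x => pfaff (M x)) ∈ coeffwise σ A := by
  have : (fun x => pfaff (M x)) = (((2 ^ n * n.factorial : ℕ) : ℂ)⁻¹) •
      ∑ p : Equiv.Perm (Fin (2 * n)), (Equiv.Perm.sign p : ℤ) •
        ∏ i : Fin n, fun x => M x (p ⟨2 * i.1, by have := i.2; omega⟩)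
          (p ⟨2 * i.1 + 1, by have := i.2; omega⟩) := by
    ext1 x
    simp [pfaff]
  rw [this]
  exact Subalgebra.smul_mem _ (Subalgebra.sum_mem _ fun p _ =>
    Subalgebra.zsmul_mem _ (Subalgebra.prod_mem _ fun i _ => hM _ _) _) _

lemma det_mem_polyFun {X ι : Type*} [Fintype ι] [DecidableEq ι] {A : Subalgebra ℂ (X → ℂ)}
    {N : X → Matrix ι ι ℂ} (hN : ∀ i j, (fun x => N x i j) ∈ A) :
    (fun x => (N x).det) ∈ A := by
  have : (fun x => (N x).det) = ∑ p : Equiv.Perm ι, (Equiv.Perm.sign p : ℤ) •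
      ∏ i, fun x => N x (p i) i := by
    ext1 x
    simp [Matrix.det_apply, Units.smul_def]
  rw [this]
  exact Subalgebra.sum_mem _ fun p _ =>
    Subalgebra.zsmul_mem _ (Subalgebra.prod_mem _ fun i _ => hN _ _) _

/-! ### Spanning forms of a given degree -/

lemma pfaff_isHomogeneous {σ : Type*} {n : ℕ}
    {M : Matrix (Fin (2 * n)) (Fin (2 * n)) (MvPolynomial σ ℂ)}
    (hM : ∀ r s, (M r s).IsHomogeneous 1) : (pfaff M).IsHomogeneous n := by
  rw [← mem_homogeneousSubmodule]
  refine Submodule.smul_mem _ _ (Submodule.sum_mem _ fun p _ => zsmul_mem ?_ _)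
  have := IsHomogeneous.prod (Finset.univ : Finset (Fin n)) (fun i =>
    M (p ⟨2 * i.1, by have := i.2; omega⟩) (p ⟨2 * i.1 + 1, by have := i.2; omega⟩))
    (fun _ => 1) fun i _ => hM _ _
  simpa using this

/-- The exponents of the monomials of degree `d` in four variables. -/
abbrev Exps (d : ℕ) : Type := (Finset.univ.finsuppAntidiag d : Finset (Fin 4 →₀ ℕ))

lemma degree_exps {d : ℕ} (m : Exps d) : (m : Fin 4 →₀ ℕ).degree = d := by
  simpa [Finsupp.degree_eq_sum] using (Finset.mem_finsuppAntidiag.1 m.2).1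

/-- The matrix of coefficients of a family of forms, one for each monomial of degree `d`. -/
noncomputable def coeffMatrix {d : ℕ} (v : Exps d → MvPolynomial (Fin 4) ℂ) :
    Matrix (Exps d) (Exps d) ℂ :=
  Matrix.of fun m m' => coeff m' (v m)

lemma exists_eval_eq_det_coeffMatrix {X T : Type*} (c : X → T → ℂ) {d : ℕ}
    {v : X → Exps d → MvPolynomial (Fin 4) ℂ}
    (hv : ∀ m, (fun x => v x m) ∈ coeffwise (Fin 4) (polyFun c)) :
    ∃ P : MvPolynomial T ℂ, ∀ x, eval (c x) P = (coeffMatrix (v x)).det :=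
  mem_polyFun_iff.1 (det_mem_polyFun fun m m' => hv m m')

lemma exists_sum_smul_of_det_ne_zero {d : ℕ} (v : Exps d → MvPolynomial (Fin 4) ℂ)
    (hv : ∀ m, (v m).IsHomogeneous d)
    (hdet : (coeffMatrix v).det ≠ 0)
    {F : MvPolynomial (Fin 4) ℂ} (hF : F.IsHomogeneous d) :
    ∃ c : Exps d → ℂ, F = ∑ m, c m • v m := by
  set N := coeffMatrix v with hN
  let f : Exps d → ℂ := fun m => coeff m F
  refine ⟨Matrix.vecMul f N⁻¹, ?_⟩
  have hf : Matrix.vecMul (Matrix.vecMul f N⁻¹) N = f := by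
    rw [Matrix.vecMul_vecMul, Matrix.nonsing_inv_mul _ (isUnit_iff_ne_zero.2 hdet),
      Matrix.vecMul_one]
  generalize Matrix.vecMul f N⁻¹ = c at hf
  ext m'
  by_cases hm : m'.degree = d
  · have := congrFun hf ⟨m', by simpa [Finsupp.degree_eq_sum] using hm⟩
    simp only [f] at this
    rw [← this]
    simp [Matrix.vecMul, dotProduct, hN, coeffMatrix, coeff_sum]
  · rw [hF.coeff_eq_zero hm, coeff_sum, Finset.sum_eq_zero]
    intro m _
    rw [coeff_smul, (hv m).coeff_eq_zero hm, smul_zero]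

/-- If modulo `I` every form of degree `n + 1` is a multiple of `L`, then the same holds
in every larger degree. -/
lemma exists_sub_mul_mem_of_le {n : ℕ} {I : Ideal (MvPolynomial (Fin 4) ℂ)}
    {L : MvPolynomial (Fin 4) ℂ}
    (h : ∀ F : MvPolynomial (Fin 4) ℂ, F.IsHomogeneous (n + 1) →
      ∃ G' : MvPolynomial (Fin 4) ℂ, G'.IsHomogeneous n ∧ F - L * G' ∈ I)
    {d : ℕ} (hd : n ≤ d) {F : MvPolynomial (Fin 4) ℂ} (hF : F.IsHomogeneous (d + 1)) :
    ∃ G' : MvPolynomial (Fin 4) ℂ, G'.IsHomogeneous d ∧ F - L * G' ∈ I := by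
  induction d, hd using Nat.le_induction generalizing F with
  | base => exact h F hF
  | succ d hd ih =>
    let S : Submodule ℂ (MvPolynomial (Fin 4) ℂ) :=
      { carrier := {F | ∃ G' : MvPolynomial (Fin 4) ℂ, G'.IsHomogeneous (d + 1) ∧ F - L * G' ∈ I}
        zero_mem' := ⟨0, isHomogeneous_zero _ _ _, by simp⟩
        add_mem' := by
          rintro a b ⟨g, hg, ha⟩ ⟨g', hg', hb⟩
          refine ⟨g + g', hg.add hg', ?_⟩
          convert I.add_mem ha hb using 1
          ring
        smul_mem' := by
          rintro r a ⟨g, hg, ha⟩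
          refine ⟨C r * g, hg.C_mul r, ?_⟩
          convert I.mul_mem_left (C r) ha using 1
          rw [smul_eq_C_mul]
          ring }
    suffices F ∈ S from this
    rw [F.as_sum]
    refine S.sum_mem fun m hm => ?_
    have hmd : m.degree = d + 1 + 1 := by
      by_contra hne
      exact mem_support_iff.1 hm (hF.coeff_eq_zero hne)
    obtain ⟨i, hi⟩ : ∃ i, m i ≠ 0 := by
      by_contra! hcon
      rw [show m = 0 from Finsupp.ext hcon] at hmd
      simp at hmd
    obtain ⟨m', rfl⟩ : ∃ m', m = Finsupp.single i 1 + m' :=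
      le_iff_exists_add.1 (Finsupp.single_le_iff.2 (Nat.one_le_iff_ne_zero.2 hi))
    have hm' : m'.degree = d + 1 := by
      rw [map_add, Finsupp.degree_single] at hmd; omega
    obtain ⟨g, hg, hgI⟩ := ih (isHomogeneous_monomial (coeff (Finsupp.single i 1 + m') F) hm')
    refine ⟨X i * g, by simpa [add_comm] using (isHomogeneous_X ℂ i).mul hg, ?_⟩
    convert I.mul_mem_left (X i) hgI using 1
    rw [monomial_single_add, pow_one]
    ring

/-! ### A matrix whose Pfaffians span all forms in three variables -/

lemma prod_mul_mem_of_mem {A : Type*} [CommRing A] [Algebra ℂ A] (W : Submodule ℂ A) (x z : A)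
    {N : ℕ} (hW : ∀ i j, i + j + 1 = N → x ^ i * z ^ (j + 1) ∈ W) (f : ℕ → ℂ) (T : Finset ℕ) :
    ∀ i j, T.card + i + j + 1 = N → (∏ m ∈ T, (x + f m • z)) * (x ^ i * z ^ (j + 1)) ∈ W := by
  induction T using Finset.induction_on with
  | empty => intro i j h; simpa using hW i j (by simpa using h)
  | insert a T ha ih =>
    intro i j h
    rw [Finset.card_insert_of_notMem ha] at h
    rw [Finset.prod_insert ha]
    convert W.add_mem (ih (i + 1) j (by omega)) (W.smul_mem (f a) (ih i (j + 1) (by omega))) using 1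
    simp only [Algebra.smul_def]
    ring

lemma prod_mul_pow_sub_pow_mem {A : Type*} [CommRing A] [Algebra ℂ A] (W : Submodule ℂ A)
    (x z : A) {N : ℕ} (hW : ∀ i j, i + j + 1 = N → x ^ i * z ^ (j + 1) ∈ W) (f : ℕ → ℂ)
    (T : Finset ℕ) :
    ∀ i, T.card + i = N → (∏ m ∈ T, (x + f m • z)) * x ^ i - x ^ N ∈ W := by
  induction T using Finset.induction_on with
  | empty => intro i h; simp [← h]
  | insert a T ha ih =>
    intro i h
    rw [Finset.card_insert_of_notMem ha] at h
    rw [Finset.prod_insert ha]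
    convert W.add_mem (ih (i + 1) (by omega))
      (W.smul_mem (f a) (prod_mul_mem_of_mem W x z hW f T i 0 (by omega))) using 1
    simp only [Algebra.smul_def]
    ring

/-- The products of the linear forms `x + m z`, `m ≤ n`, with a window of `b + 1` consecutive
factors left out, span all binary forms of degree `n - b`. -/
lemma pow_mul_pow_mem_of_window_prod_mem {A : Type*} [CommRing A] [Algebra ℂ A] (x z : A) (n : ℕ) :
    ∀ (N b : ℕ), b + N = n → ∀ W : Submodule ℂ A,
      (∀ a ≤ N, (∏ m ∈ Finset.range a, (x + (m : ℂ) • z)) *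
        ∏ m ∈ Finset.Ico (a + b + 1) (n + 1), (x + (m : ℂ) • z) ∈ W) →
      ∀ i j, i + j = N → x ^ i * z ^ j ∈ W := by
  intro N
  induction N with
  | zero =>
    intro b hb W hW i j hij
    obtain ⟨rfl, rfl⟩ : i = 0 ∧ j = 0 := by omega
    have := hW 0 le_rfl
    rw [Finset.Ico_eq_empty (by omega)] at this
    simpa using this
  | succ N ih =>
    intro b hb W hW
    have hz : ∀ i j, i + j + 1 = N + 1 → x ^ i * z ^ (j + 1) ∈ W := by
      intro i j hij
      have := ih (b + 1) (by omega) (W.comap (LinearMap.mulLeft ℂ z)) ?_ i j (by omega)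
      · rw [Submodule.mem_comap, LinearMap.mulLeft_apply] at this
        convert this using 1
        ring
      · intro a ha
        rw [Submodule.mem_comap, LinearMap.mulLeft_apply]
        have h1 := hW (a + 1) (by omega)
        have h2 := hW a (by omega)
        rw [Finset.prod_range_succ] at h1
        rw [Finset.prod_eq_prod_Ico_succ_bot (by omega)] at h2
        rw [show a + 1 + b + 1 = a + b + 1 + 1 by ring] at h1
        rw [show a + (b + 1) + 1 = a + b + 1 + 1 by ring]
        have hb0 : (-((b : ℂ) + 1)) ≠ 0 := neg_ne_zero.2 (by exact_mod_cast Nat.succ_ne_zero b)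
        rw [← W.smul_mem_iff hb0]
        convert W.sub_mem h1 h2 using 1
        simp only [Algebra.smul_def]
        push_cast [map_add, map_neg, map_one]
        ring
    intro i j hij
    rcases j with _ | j
    · obtain rfl : i = N + 1 := by omega
      have h1 := prod_mul_pow_sub_pow_mem W x z hz (fun m => (m : ℂ))
        (Finset.Ico (b + 1) (n + 1)) 0 (by rw [Nat.card_Ico]; omega)
      have h2 := hW 0 (by omega)
      rw [Finset.range_zero, Finset.prod_empty, one_mul, zero_add] at h2
      convert W.sub_mem h2 h1 using 1
      ring
    · exact hz i j hij

/-- The weight of the edge between `v` and `v + 1`. -/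
noncomputable def edgeWeight (v : ℕ) : MvPolynomial (Fin 4) ℂ :=
  if v % 2 = 0 then X 0 + ((v / 2 : ℕ) : ℂ) • X 2 else X 1

/-- The tridiagonal skew-symmetric matrix with the weights `edgeWeight` above the diagonal. -/
noncomputable def pathMatrix (N : ℕ) : Matrix (Fin N) (Fin N) (MvPolynomial (Fin 4) ℂ) :=
  fun r c => if (r : ℕ) + 1 = c then edgeWeight r else
    if (c : ℕ) + 1 = r then -edgeWeight c else 0

lemma pathMatrix_isSkew (N : ℕ) : IsSkew (pathMatrix N) := by
  intro i j
  unfold pathMatrix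
  split_ifs <;> first | omega | simp

lemma edgeWeight_isHomogeneous (v : ℕ) : (edgeWeight v).IsHomogeneous 1 := by
  unfold edgeWeight
  split_ifs
  · rw [smul_eq_C_mul]
    exact (isHomogeneous_X _ _).add ((isHomogeneous_X _ _).C_mul _)
  · exact isHomogeneous_X _ _

lemma pathMatrix_isHomogeneous {N : ℕ} (r c : Fin N) : (pathMatrix N r c).IsHomogeneous 1 := by
  unfold pathMatrix
  split_ifs
  · exact edgeWeight_isHomogeneous _
  · exact (edgeWeight_isHomogeneous _).neg
  · exact isHomogeneous_zero _ _ _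

/-- The embedding of `Fin (2 * n)` in `Fin (2 * (n + 1))` omitting `2 * i` and `2 * j + 1`. -/
def erasePair (n i j : ℕ) : Fin (2 * n) ↪o Fin (2 * (n + 1)) :=
  OrderEmbedding.ofStrictMono
    (fun u => ⟨if (u : ℕ) < 2 * i then (u : ℕ) else if (u : ℕ) < 2 * j then u + 1 else u + 2, by
      have := u.2; split_ifs <;> omega⟩)
    (fun u v h => by
      rw [Fin.lt_def] at h ⊢
      dsimp only
      split_ifs <;> omega)

lemma erasePair_val (n i j : ℕ) (u : Fin (2 * n)) :
    (erasePair n i j u : ℕ) =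
      if (u : ℕ) < 2 * i then (u : ℕ) else if (u : ℕ) < 2 * j then (u : ℕ) + 1 else u + 2 := rfl

/-- The Pfaffian obtained from `pathMatrix` by erasing `2 * a` and `2 * (a + b) + 1`. -/
lemma exists_smul_pfaff_pathMatrix {n : ℕ} (a b : ℕ) (hab : a + b ≤ n) :
    ∃ c : ℂ, c • pfaff ((pathMatrix (2 * (n + 1))).submatrix
        (erasePair n a (a + b)) (erasePair n a (a + b))) =
      X 1 ^ b * ((∏ m ∈ Finset.range a, (X 0 + (m : ℂ) • X 2)) *
        ∏ m ∈ Finset.Ico (a + b + 1) (n + 1), (X 0 + (m : ℂ) • X 2)) := by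
  obtain ⟨c, hc⟩ := exists_smul_pfaff_of_tridiagonal ((pathMatrix (2 * (n + 1))).submatrix
    (erasePair n a (a + b)) (erasePair n a (a + b)))
    (fun i j => pathMatrix_isSkew _ _ _) (by
      intro u v huv
      by_contra hcon
      apply huv
      rw [Matrix.submatrix_apply]
      unfold pathMatrix
      rw [if_neg, if_neg]
      all_goals
        simp only [erasePair_val]
        split_ifs <;> omega)
  refine ⟨c, hc.trans ?_⟩
  let w : ℕ → MvPolynomial (Fin 4) ℂ := fun m =>
    if m < a then X 0 + (m : ℂ) • X 2 else if m < a + b then X 1 else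
      X 0 + ((m + 1 : ℕ) : ℂ) • X 2
  have hw : ∀ i : Fin n, (pathMatrix (2 * (n + 1))).submatrix
      (erasePair n a (a + b)) (erasePair n a (a + b))
      (pairEquiv n (i, 0)) (pairEquiv n (i, 1)) = w i := by
    intro i
    rw [Matrix.submatrix_apply]
    unfold pathMatrix
    rw [if_pos (by
      simp only [erasePair_val, pairEquiv_val, Fin.val_zero, Fin.val_one]
      split_ifs <;> omega)]
    simp only [edgeWeight, erasePair_val, pairEquiv_val, Fin.val_zero, w]
    by_cases h1 : (i : ℕ) < a
    · rw [if_pos (show 2 * (i : ℕ) + 0 < 2 * a by omega), if_pos (by omega), if_pos h1]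
      simp
    · rw [if_neg (show ¬ 2 * (i : ℕ) + 0 < 2 * a by omega), if_neg h1]
      by_cases h2 : (i : ℕ) < a + b
      · rw [if_pos (show 2 * (i : ℕ) + 0 < 2 * (a + b) by omega), if_neg (by omega), if_pos h2]
      · rw [if_neg (show ¬ 2 * (i : ℕ) + 0 < 2 * (a + b) by omega), if_pos (by omega), if_neg h2,
          show (2 * (i : ℕ) + 0 + 2) / 2 = i + 1 by omega]
  rw [Finset.prod_congr rfl fun i _ => hw i, Fin.prod_univ_eq_prod_range w n, Finset.range_eq_Ico,
    ← Finset.prod_Ico_consecutive w (Nat.zero_le (a + b)) hab,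
    ← Finset.prod_Ico_consecutive w (Nat.zero_le a) (Nat.le_add_right a b)]
  have h1 : ∏ m ∈ Finset.Ico 0 a, w m =
      ∏ m ∈ Finset.Ico 0 a, (X 0 + (m : ℂ) • X 2 : MvPolynomial (Fin 4) ℂ) :=
    Finset.prod_congr rfl fun m hm => if_pos (Finset.mem_Ico.1 hm).2
  have h2 : ∏ m ∈ Finset.Ico a (a + b), w m = X 1 ^ b := by
    rw [Finset.prod_congr rfl (g := fun _ => (X 1 : MvPolynomial (Fin 4) ℂ))]
    · simp
    · intro m hm
      rw [Finset.mem_Ico] at hm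
      simp only [w]
      rw [if_neg (by omega), if_pos hm.2]
  have h3 : ∏ m ∈ Finset.Ico (a + b) n, w m =
      ∏ m ∈ Finset.Ico (a + b + 1) (n + 1), (X 0 + (m : ℂ) • X 2 : MvPolynomial (Fin 4) ℂ) := by
    rw [← Finset.prod_Ico_add' (fun m : ℕ => (X 0 + (m : ℂ) • X 2 : MvPolynomial (Fin 4) ℂ))]
    refine Finset.prod_congr rfl fun m hm => ?_
    rw [Finset.mem_Ico] at hm
    simp only [w]
    rw [if_neg (by omega), if_neg (by omega)]
  rw [h1, h2, h3, ← Finset.range_eq_Ico]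
  ring

lemma monomial_mem_span_pfaff {n : ℕ} {m : Fin 4 →₀ ℕ} (hm : m.degree = n) (h3 : m 3 = 0) :
    monomial m (1 : ℂ) ∈ Submodule.span ℂ (Set.range fun e : Fin (2 * n) ↪o Fin (2 * (n + 1)) =>
      pfaff ((pathMatrix (2 * (n + 1))).submatrix e e)) := by
  set V := Submodule.span ℂ (Set.range fun e : Fin (2 * n) ↪o Fin (2 * (n + 1)) =>
      pfaff ((pathMatrix (2 * (n + 1))).submatrix e e))
  have hdeg : m 0 + m 1 + m 2 = n := by
    simpa [Finsupp.degree_eq_sum, Fin.sum_univ_four, h3] using hm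
  have := pow_mul_pow_mem_of_window_prod_mem (X 0 : MvPolynomial (Fin 4) ℂ) (X 2) n
    (m 0 + m 2) (m 1) (by omega) (V.comap (LinearMap.mulLeft ℂ (X 1 ^ m 1))) (by
      intro a ha
      rw [Submodule.mem_comap, LinearMap.mulLeft_apply]
      obtain ⟨c, hc⟩ := exists_smul_pfaff_pathMatrix (n := n) a (m 1) (by omega)
      rw [← hc]
      exact V.smul_mem _ (Submodule.subset_span ⟨_, rfl⟩)) (m 0) (m 2) rfl
  rw [Submodule.mem_comap, LinearMap.mulLeft_apply] at this
  convert this using 1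
  rw [monomial_eq, Finsupp.prod_fintype _ _ (by simp), Fin.prod_univ_four, h3]
  simp
  ring

/-- The form `L * g + h * q`, where `q` is the linear combination of the submaximal Pfaffians of `G`
with coefficients `c`. -/
noncomputable def pfaffComb {n : ℕ} (g h : MvPolynomial (Fin 4) ℂ)
    (c : (Fin (2 * n) ↪o Fin (2 * (n + 1))) →₀ ℂ)
    (G : Matrix (Fin (2 * (n + 1))) (Fin (2 * (n + 1))) (MvPolynomial (Fin 4) ℂ))
    (L : MvPolynomial (Fin 4) ℂ) : MvPolynomial (Fin 4) ℂ :=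
  L * g + h * ∑ e ∈ c.support, c e • pfaff (G.submatrix e e)

lemma exists_pfaffComb_eq_monomial {n : ℕ} (m : Exps (n + 1)) :
    ∃ (g h : MvPolynomial (Fin 4) ℂ) (c : (Fin (2 * n) ↪o Fin (2 * (n + 1))) →₀ ℂ),
      g.IsHomogeneous n ∧ h.IsHomogeneous 1 ∧
      pfaffComb g h c (pathMatrix _) (X 3) = monomial (m : Fin 4 →₀ ℕ) (1 : ℂ) := by
  unfold pfaffComb
  have hsplit : ∀ i, (m : Fin 4 →₀ ℕ) i ≠ 0 →
      ∃ m' : Fin 4 →₀ ℕ, (m : Fin 4 →₀ ℕ) = Finsupp.single i 1 + m' ∧ m'.degree = n := by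
    intro i hi
    obtain ⟨m', hm'⟩ :=
      le_iff_exists_add.1 (Finsupp.single_le_iff.2 (Nat.one_le_iff_ne_zero.2 hi))
    refine ⟨m', hm', ?_⟩
    have := degree_exps m
    rw [hm', map_add, Finsupp.degree_single] at this
    omega
  by_cases h3 : (m : Fin 4 →₀ ℕ) 3 = 0
  · obtain ⟨i, hi⟩ : ∃ i, (m : Fin 4 →₀ ℕ) i ≠ 0 := by
      by_contra! hcon
      have := degree_exps m
      rw [show (m : Fin 4 →₀ ℕ) = 0 from Finsupp.ext hcon] at this
      simp at this
    obtain ⟨m', hm', hd⟩ := hsplit i hi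
    have h3' : m' 3 = 0 := by
      rw [hm', Finsupp.add_apply] at h3
      omega
    obtain ⟨c, hc⟩ := Finsupp.mem_span_range_iff_exists_finsupp.1 (monomial_mem_span_pfaff hd h3')
    refine ⟨0, X i, c, isHomogeneous_zero _ _ _, isHomogeneous_X _ _, ?_⟩
    rw [Finsupp.sum] at hc
    rw [hc, hm', monomial_single_add]
    ring
  · obtain ⟨m', hm', hd⟩ := hsplit 3 h3
    refine ⟨monomial m' 1, 0, 0, isHomogeneous_monomial _ hd, isHomogeneous_zero _ _ _, ?_⟩
    rw [hm', monomial_single_add]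
    ring

lemma pfaffComb_mem_coeffwise {X : Type*} {A : Subalgebra ℂ (X → ℂ)} {n : ℕ}
    (g h : MvPolynomial (Fin 4) ℂ) (c : (Fin (2 * n) ↪o Fin (2 * (n + 1))) →₀ ℂ)
    {G : X → Matrix (Fin (2 * (n + 1))) (Fin (2 * (n + 1))) (MvPolynomial (Fin 4) ℂ)}
    {L : X → MvPolynomial (Fin 4) ℂ}
    (hG : ∀ r s, (fun x => G x r s) ∈ coeffwise (Fin 4) A) (hL : L ∈ coeffwise (Fin 4) A) :
    (fun x => pfaffComb g h c (G x) (L x)) ∈ coeffwise (Fin 4) A := by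
  have : (fun x => pfaffComb g h c (G x) (L x)) = L * (fun _ => g) + (fun _ => h) *
      ∑ e ∈ c.support, c e • fun x => pfaff ((G x).submatrix e e) := by
    ext1 x
    simp [pfaffComb]
  rw [this]
  exact Subalgebra.add_mem _ (Subalgebra.mul_mem _ hL (const_mem_coeffwise _ g))
    (Subalgebra.mul_mem _ (const_mem_coeffwise _ h) (Subalgebra.sum_mem _ fun e _ =>
      Subalgebra.smul_mem _ (pfaff_mem_coeffwise fun r s => hG (e r) (e s)) _))

lemma pfaffComb_isHomogeneous {n : ℕ} {g h : MvPolynomial (Fin 4) ℂ}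
    {c : (Fin (2 * n) ↪o Fin (2 * (n + 1))) →₀ ℂ}
    {G : Matrix (Fin (2 * (n + 1))) (Fin (2 * (n + 1))) (MvPolynomial (Fin 4) ℂ)}
    {L : MvPolynomial (Fin 4) ℂ} (hg : g.IsHomogeneous n) (hh : h.IsHomogeneous 1)
    (hG : ∀ r s, (G r s).IsHomogeneous 1) (hL : L.IsHomogeneous 1) :
    (pfaffComb g h c G L).IsHomogeneous (n + 1) := by
  have hq : (∑ e ∈ c.support, c e • pfaff (G.submatrix e e)).IsHomogeneous n :=
    (homogeneousSubmodule (Fin 4) ℂ n).sum_mem fun e _ => Submodule.smul_mem _ _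
      (pfaff_isHomogeneous fun r s => hG (e r) (e s))
  rw [add_comm n 1]
  exact (hL.mul hg).add (hh.mul hq)

lemma pfaffComb_sub_mem {n : ℕ} (g h : MvPolynomial (Fin 4) ℂ)
    (c : (Fin (2 * n) ↪o Fin (2 * (n + 1))) →₀ ℂ)
    (G : Matrix (Fin (2 * (n + 1))) (Fin (2 * (n + 1))) (MvPolynomial (Fin 4) ℂ))
    (L : MvPolynomial (Fin 4) ℂ) :
    pfaffComb g h c G L - L * g ∈ Ideal.span (submaxPfEven G) := by
  rw [pfaffComb, add_sub_cancel_left]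
  refine Ideal.mul_mem_left _ _ (Ideal.sum_mem _ fun e _ => ?_)
  rw [smul_eq_C_mul]
  exact Ideal.mul_mem_left _ _ (Ideal.subset_span ⟨e, rfl⟩)

/-- Let `G` be a general skew-symmetric `2k × 2k` matrix of linear forms
in four variables and let `I` be the ideal generated by its submaximal Pfaffians. Then for
every general linear form `L`, multiplication by `L` gives a surjection
`(R/I)_{d-1} → (R/I)_d` for all `d ≥ k`: every form `F` of degree `d` is congruent
modulo `I` to `L * G'` for some form `G'` of degree `d - 1`.
Genericity (for `G` and then for `L`) is expressed by nonzero polynomials in the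
coefficients, cutting out nonempty Zariski-open subsets of the parameter spaces. -/
theorem mult_by_general_linear_form_surjective_modulo_linear_pfaffian_ideal
    (k : ℕ) (hk : 0 < k) :
    ∃ P : MvPolynomial (Fin (2*k) × Fin (2*k) × ((Fin 4) →₀ ℕ)) ℂ, P ≠ 0 ∧
      (∃ G : Matrix (Fin (2*k)) (Fin (2*k)) (MvPolynomial (Fin 4) ℂ),
        IsSkew G ∧ (∀ r c, (G r c).IsHomogeneous 1) ∧
        MvPolynomial.eval (fun x => MvPolynomial.coeff x.2.2 (G x.1 x.2.1)) P ≠ 0) ∧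
      ∀ G : Matrix (Fin (2*k)) (Fin (2*k)) (MvPolynomial (Fin 4) ℂ),
        IsSkew G → (∀ r c, (G r c).IsHomogeneous 1) →
        MvPolynomial.eval (fun x => MvPolynomial.coeff x.2.2 (G x.1 x.2.1)) P ≠ 0 →
        ∃ Q : MvPolynomial ((Fin 4) →₀ ℕ) ℂ, Q ≠ 0 ∧
          (∃ L : MvPolynomial (Fin 4) ℂ, L.IsHomogeneous 1 ∧
            MvPolynomial.eval (fun m => MvPolynomial.coeff m L) Q ≠ 0) ∧
          ∀ L : MvPolynomial (Fin 4) ℂ, L.IsHomogeneous 1 →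
            MvPolynomial.eval (fun m => MvPolynomial.coeff m L) Q ≠ 0 →
            ∀ d : ℕ, k ≤ d →
              ∀ F : MvPolynomial (Fin 4) ℂ, F.IsHomogeneous d →
                ∃ G' : MvPolynomial (Fin 4) ℂ, G'.IsHomogeneous (d - 1) ∧
                  F - L * G' ∈ Ideal.span (submaxPfEven G) := by
  obtain ⟨n, rfl⟩ : ∃ n, k = n + 1 := ⟨k - 1, by omega⟩
  choose g h c hg hh hgh using exists_pfaffComb_eq_monomial (n := n)
  have hdet : (coeffMatrix fun m => pfaffComb (g m) (h m) (c m) (pathMatrix _) (X 3)).det ≠ 0 := by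
    have : (coeffMatrix fun m => pfaffComb (g m) (h m) (c m) (pathMatrix _) (X 3)) = 1 := by
      ext m m'
      simp only [coeffMatrix, Matrix.of_apply, hgh, coeff_monomial, Matrix.one_apply,
        Subtype.ext_iff]
    rw [this, Matrix.det_one]
    exact one_ne_zero
  obtain ⟨P, hP⟩ := exists_eval_eq_det_coeffMatrix
    (fun (G : Matrix (Fin (2 * (n + 1))) (Fin (2 * (n + 1))) (MvPolynomial (Fin 4) ℂ))
      (x : Fin (2 * (n + 1)) × Fin (2 * (n + 1)) × (Fin 4 →₀ ℕ)) => coeff x.2.2 (G x.1 x.2.1))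
    (v := fun G m => pfaffComb (g m) (h m) (c m) G (X 3))
    fun m => pfaffComb_mem_coeffwise _ _ _ (fun r s d => coord_mem_polyFun _ (r, s, d))
      (const_mem_coeffwise _ _)
  have hP0 := (hP (pathMatrix _)).trans_ne hdet
  refine ⟨P, ?_, ⟨pathMatrix _, pathMatrix_isSkew _, pathMatrix_isHomogeneous, hP0⟩, ?_⟩
  · rintro rfl
    exact hP0 (map_zero _)
  intro G _ hG hPG
  rw [hP] at hPG
  obtain ⟨Q, hQ⟩ := exists_eval_eq_det_coeffMatrix
    (fun (L : MvPolynomial (Fin 4) ℂ) (m : Fin 4 →₀ ℕ) => coeff m L)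
    (v := fun L m => pfaffComb (g m) (h m) (c m) G L)
    fun m => pfaffComb_mem_coeffwise _ _ _ (fun r s => const_mem_coeffwise _ _)
      fun d => coord_mem_polyFun _ d
  have hQ0 := (hQ (X 3)).trans_ne hPG
  refine ⟨Q, ?_, ⟨X 3, isHomogeneous_X _ _, hQ0⟩, ?_⟩
  · rintro rfl
    exact hQ0 (map_zero _)
  intro L hL hQL d hd F hF
  rw [hQ] at hQL
  obtain ⟨d, rfl⟩ : ∃ d', d = d' + 1 := ⟨d - 1, by omega⟩
  refine exists_sub_mul_mem_of_le (n := n) (fun F hF => ?_) (by omega) hF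
  obtain ⟨a, ha⟩ := exists_sum_smul_of_det_ne_zero _
    (fun m => pfaffComb_isHomogeneous (hg m) (hh m) hG hL) hQL hF
  refine ⟨∑ m, a m • g m,
    (homogeneousSubmodule (Fin 4) ℂ n).sum_mem fun m _ => Submodule.smul_mem _ _ (hg m), ?_⟩
  rw [ha, Finset.mul_sum, ← Finset.sum_sub_distrib]
  refine Ideal.sum_mem _ fun m _ => ?_
  rw [mul_smul_comm, ← smul_sub, smul_eq_C_mul]
  exact Ideal.mul_mem_left _ _ (pfaffComb_sub_mem _ _ _ _ _)
end

section
/- Let A = (a_{ij}) be a 4×4 symmetric homogeneous matrix of non-negative integers and set d = tr(A)/2. Then a general homogeneous form of degree d in ℂ[x1,x2,x3,x4] is the sum of two Pfaffians of skew-symmetric 4×4 matrices of homogeneous forms, each with degree matrix A. -/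
open MvPolynomial

theorem exists_eval_ne_zero_subset_range {σ τ : Type*} [Finite σ] [Finite τ]
    (φ : σ → MvPolynomial τ ℂ) (hφ : AlgebraicIndependent ℂ φ) :
    ∃ P : MvPolynomial σ ℂ, P ≠ 0 ∧
      ∀ y : σ → ℂ, eval y P ≠ 0 → ∃ x : τ → ℂ, ∀ s, eval x (φ s) = y s := by
  let f : MvPolynomial σ ℂ →+* MvPolynomial τ ℂ := (aeval φ : MvPolynomial σ ℂ →ₐ[ℂ] _).toRingHom
  have hinj : Function.Injective f := hφ
  have hfp : f.FinitePresentation := by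
    have hft : (aeval φ : MvPolynomial σ ℂ →ₐ[ℂ] MvPolynomial τ ℂ).FiniteType := by
      refine RingHom.FiniteType.of_comp_finiteType (f := algebraMap ℂ (MvPolynomial σ ℂ)) ?_
      exact (AlgHom.comp_algebraMap (aeval φ : MvPolynomial σ ℂ →ₐ[ℂ] MvPolynomial τ ℂ)).symm ▸
        RingHom.finiteType_algebraMap.mpr inferInstance
    exact RingHom.FinitePresentation.of_finiteType.mp hft
  obtain ⟨S, hS⟩ := PrimeSpectrum.exists_constructibleSetData_iff.mpr
    (PrimeSpectrum.isConstructible_range_comap hfp)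
  have hbot : (⊥ : PrimeSpectrum (MvPolynomial σ ℂ)) ∈ S.toSet := by
    rw [hS]
    refine ⟨⊥, PrimeSpectrum.ext ?_⟩
    exact (RingHom.injective_iff_ker_eq_bot f).mp hinj
  simp only [PrimeSpectrum.ConstructibleSetData.toSet, Set.mem_iUnion] at hbot
  obtain ⟨T, hT, hTg, hTf⟩ := hbot
  have hf0 : T.f ≠ 0 := fun h => hTf (by simp [h])
  have hg0 (i) : T.g i = 0 := by simpa using hTg ⟨i, rfl⟩
  refine ⟨T.f, hf0, fun y hy => ?_⟩
  let m : PrimeSpectrum (MvPolynomial σ ℂ) := ⟨RingHom.ker (eval y), RingHom.ker_isPrime _⟩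
  have hm : m ∈ S.toSet := by
    simp only [PrimeSpectrum.ConstructibleSetData.toSet, Set.mem_iUnion]
    refine ⟨T, hT, ?_, ?_⟩
    · rintro _ ⟨i, rfl⟩
      rw [hg0]
      exact zero_mem _
    · simpa [m, PrimeSpectrum.mem_zeroLocus] using hy
  rw [hS] at hm
  obtain ⟨q, hq⟩ := hm
  obtain ⟨M, hM, hqM⟩ := Ideal.exists_le_maximal q.asIdeal q.2.ne_top
  obtain ⟨x, rfl⟩ := (isMaximal_iff_eq_vanishingIdeal_singleton (K := ℂ)).mp hM
  refine ⟨x, fun s => ?_⟩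
  have hmem : X s - C (y s) ∈ m.asIdeal := by simp [m, RingHom.mem_ker]
  rw [← hq] at hmem
  have := (mem_vanishingIdeal_singleton_iff x _).mp (hqM hmem)
  simpa [f, sub_eq_zero, aeval_eq_eval] using this

theorem algebraicIndependent_of_expansions {σ τ : Type*} [Fintype σ] [Fintype τ]
    (φ : σ → MvPolynomial τ ℂ) (x : τ → ℂ)
    (hx : ∀ y : σ → ℂ, ∃ (v : τ → ℂ) (w : σ → ℂ), ∀ (s : σ) (t : ℂ),
      eval (x + t • v) (φ s) = eval x (φ s) + t * y s + t ^ 2 * w s) :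
    AlgebraicIndependent ℂ φ := by
  rw [algebraicIndependent_iff]
  intro p hp
  have han (s : σ) : AnalyticAt ℂ (fun x : τ → ℂ => eval x (φ s)) x :=
    AnalyticOnNhd.eval_mvPolynomial (φ s) x (Set.mem_univ x)
  have hder := hasStrictFDerivAt_pi.mpr fun s => (han s).hasStrictFDerivAt
  have hrange := hder.map_nhds_eq_of_surj (by
    rw [LinearMap.range_eq_top]
    intro y
    obtain ⟨v, w, hvw⟩ := hx y
    refine ⟨v, funext fun s => ?_⟩
    have hline : HasDerivAt (fun t : ℂ => x + t • v) v 0 := by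
      simpa using ((hasDerivAt_id (0 : ℂ)).smul_const v).const_add x
    have h1 : HasDerivAt (fun t : ℂ => eval (x + t • v) (φ s))
        (fderiv ℂ (fun x : τ → ℂ => eval x (φ s)) x v) 0 :=
      HasFDerivAt.comp_hasDerivAt_of_eq (0 : ℂ) (han s).hasStrictFDerivAt.hasFDerivAt hline
        (by simp)
    have h2 : HasDerivAt (fun t : ℂ => eval (x + t • v) (φ s)) (y s) 0 := by
      simp only [hvw]
      simpa using! (((hasDerivAt_id (0 : ℂ)).mul_const (y s)).const_add (eval x (φ s))).add
        (((hasDerivAt_id (0 : ℂ)).pow 2).mul_const (w s))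
    simpa using h1.unique h2)
  have hzero : ∀ᶠ y in nhds (fun s => eval x (φ s)), eval y p = 0 := by
    rw [← hrange]
    refine Filter.eventually_map.mpr (Filter.Eventually.of_forall fun x' => ?_)
    have := congrArg (aeval x' : MvPolynomial τ ℂ →ₐ[ℂ] ℂ) hp
    rwa [comp_aeval_apply, map_zero, aeval_eq_eval] at this
  rw [Metric.eventually_nhds_iff_ball] at hzero
  obtain ⟨ε, hε, hball⟩ := hzero
  rw [ball_pi _ hε] at hball
  refine funext_set (fun s => Metric.ball (eval x (φ s)) ε) (fun s => ?_) fun y hy => ?_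
  · exact infinite_of_mem_nhds _ (Metric.ball_mem_nhds _ hε)
  · simpa using hball y hy

/-- The exponents of the monomials of degree `k` in four variables. -/
abbrev Exponents (k : ℕ) : Type := Finset.finsuppAntidiag (Finset.univ : Finset (Fin 4)) k

theorem mem_finsuppAntidiag_univ {k : ℕ} {m : Fin 4 →₀ ℕ} :
    m ∈ Finset.finsuppAntidiag (Finset.univ : Finset (Fin 4)) k ↔ m.degree = k := by
  simp [Finset.mem_finsuppAntidiag, Finsupp.degree_eq_sum]

/-- The form of degree `k` in four variables with given coefficients. -/
noncomputable def formOfCoeffs {R : Type*} [CommRing R] {k : ℕ} (c : Exponents k → R) :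
    MvPolynomial (Fin 4) R :=
  ∑ m, monomial m.1 (c m)

theorem formOfCoeffs_isHomogeneous {R : Type*} [CommRing R] {k : ℕ} (c : Exponents k → R) :
    (formOfCoeffs c).IsHomogeneous k :=
  IsHomogeneous.sum _ _ _ fun m _ =>
    isHomogeneous_monomial _ (mem_finsuppAntidiag_univ.mp m.2)

theorem formOfCoeffs_coeff {R : Type*} [CommRing R] {k : ℕ} {f : MvPolynomial (Fin 4) R}
    (hf : f.IsHomogeneous k) : formOfCoeffs (fun m : Exponents k => coeff m.1 f) = f := by
  unfold formOfCoeffs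
  rw [Finset.sum_coe_sort _ (fun m => monomial m (coeff m f))]
  conv_rhs => rw [f.as_sum]
  refine (Finset.sum_subset (fun m hm => ?_) fun m _ hm => ?_).symm
  · rw [mem_finsuppAntidiag_univ, Finsupp.degree_eq_weight_one]
    exact hf (mem_support_iff.mp hm)
  · rw [notMem_support_iff.mp hm, monomial_zero]

theorem coeff_formOfCoeffs {R : Type*} [CommRing R] {k : ℕ} (c : Exponents k → R)
    (m : Exponents k) : coeff m.1 (formOfCoeffs c) = c m := by
  simp [formOfCoeffs, coeff_sum, coeff_monomial]

theorem formOfCoeffs_add_smul {k : ℕ} (c c' : Exponents k → ℂ) (t : ℂ) :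
    formOfCoeffs (fun m => c m + t * c' m) = formOfCoeffs c + C t * formOfCoeffs c' := by
  simp [formOfCoeffs, Finset.mul_sum, C_mul_monomial, Finset.sum_add_distrib]

theorem map_formOfCoeffs {R S : Type*} [CommRing R] [CommRing S] {k : ℕ} (g : R →+* S)
    (c : Exponents k → R) : map g (formOfCoeffs c) = formOfCoeffs (fun m => g (c m)) := by
  simp [formOfCoeffs, map_monomial]

/-- If every form of degree `d` is tangent to the sums `∑ i, h i * k i` at one of them, then a
general form of degree `d` is such a sum. -/
theorem exists_eval_ne_zero_sum_mul {ι : Type*} [Fintype ι] {d : ℕ} {e e' : ι → ℕ}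
    (he : ∀ i, e i + e' i = d)
    {f g : ι → MvPolynomial (Fin 4) ℂ} (hf : ∀ i, (f i).IsHomogeneous (e i))
    (hg : ∀ i, (g i).IsHomogeneous (e' i))
    (htangent : ∀ F : MvPolynomial (Fin 4) ℂ, F.IsHomogeneous d →
      ∃ h k : ι → MvPolynomial (Fin 4) ℂ, (∀ i, (h i).IsHomogeneous (e i)) ∧
        (∀ i, (k i).IsHomogeneous (e' i)) ∧ F = ∑ i, (f i * k i + h i * g i)) :
    ∃ P : MvPolynomial (Fin 4 →₀ ℕ) ℂ, P ≠ 0 ∧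
      (∃ F : MvPolynomial (Fin 4) ℂ, F.IsHomogeneous d ∧ eval (fun m => coeff m F) P ≠ 0) ∧
      ∀ F : MvPolynomial (Fin 4) ℂ, F.IsHomogeneous d → eval (fun m => coeff m F) P ≠ 0 →
        ∃ h k : ι → MvPolynomial (Fin 4) ℂ, (∀ i, (h i).IsHomogeneous (e i)) ∧
          (∀ i, (k i).IsHomogeneous (e' i)) ∧ F = ∑ i, h i * k i := by
  let τ := (Σ i, Exponents (e i)) ⊕ (Σ i, Exponents (e' i))
  let Θ : MvPolynomial (Fin 4) (MvPolynomial τ ℂ) :=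
    ∑ i, formOfCoeffs (fun m : Exponents (e i) => X (Sum.inl ⟨i, m⟩)) *
      formOfCoeffs (fun m : Exponents (e' i) => X (Sum.inr ⟨i, m⟩))
  let φ (s : Exponents d) : MvPolynomial τ ℂ := coeff s.1 Θ
  have heval (x : τ → ℂ) (s : Exponents d) : eval x (φ s) =
      coeff s.1 (∑ i, formOfCoeffs (fun m : Exponents (e i) => x (Sum.inl ⟨i, m⟩)) *
        formOfCoeffs (fun m : Exponents (e' i) => x (Sum.inr ⟨i, m⟩))) := by
    rw [← coeff_map]
    simp [Θ, map_formOfCoeffs]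
  let pack (h k : ι → MvPolynomial (Fin 4) ℂ) : τ → ℂ :=
    Sum.elim (fun m => coeff m.2.1 (h m.1)) (fun m => coeff m.2.1 (k m.1))
  have hind : AlgebraicIndependent ℂ φ := by
    refine algebraicIndependent_of_expansions φ (pack f g) fun y => ?_
    obtain ⟨h, k, hh, hk, hy⟩ := htangent (formOfCoeffs y) (formOfCoeffs_isHomogeneous y)
    refine ⟨pack h k, fun s => coeff s.1 (∑ i, h i * k i), fun s t => ?_⟩
    simp only [heval, pack, Pi.add_apply, Pi.smul_apply, Sum.elim_inl, Sum.elim_inr, smul_eq_mul,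
      formOfCoeffs_add_smul, formOfCoeffs_coeff (hf _), formOfCoeffs_coeff (hg _),
      formOfCoeffs_coeff (hh _), formOfCoeffs_coeff (hk _)]
    rw [← coeff_formOfCoeffs y s, hy, ← coeff_C_mul, ← coeff_C_mul, ← coeff_add, ← coeff_add,
      Finset.mul_sum, Finset.mul_sum, ← Finset.sum_add_distrib, ← Finset.sum_add_distrib]
    congr 1
    refine Finset.sum_congr rfl fun i _ => ?_
    rw [C_pow]
    ring
  obtain ⟨P, hP, hlift⟩ := exists_eval_ne_zero_subset_range φ hind
  have hren (F : MvPolynomial (Fin 4) ℂ) :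
      eval (fun m => coeff m F) (rename Subtype.val P) = eval (fun s => coeff s.1 F) P := by
    rw [eval_rename]
    rfl
  refine ⟨rename Subtype.val P, ?_, ?_, fun F hF hne => ?_⟩
  · rwa [Ne, map_eq_zero_iff _ (rename_injective _ Subtype.val_injective)]
  · obtain ⟨y, hy⟩ : ∃ y, eval y P ≠ 0 := by
      by_contra! hall
      exact hP (MvPolynomial.funext fun y => by simpa using hall y)
    refine ⟨formOfCoeffs y, formOfCoeffs_isHomogeneous y, ?_⟩
    rw [hren]
    simpa only [coeff_formOfCoeffs] using hy
  · rw [hren] at hne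
    obtain ⟨x, hx⟩ := hlift _ hne
    refine ⟨fun i => formOfCoeffs fun m => x (Sum.inl ⟨i, m⟩),
      fun i => formOfCoeffs fun m => x (Sum.inr ⟨i, m⟩),
      fun i => formOfCoeffs_isHomogeneous _, fun i => formOfCoeffs_isHomogeneous _, ?_⟩
    simp only [heval] at hx
    rw [← formOfCoeffs_coeff hF]
    simp only [← hx]
    exact formOfCoeffs_coeff <| IsHomogeneous.sum _ _ _ fun i _ => he i ▸
      (formOfCoeffs_isHomogeneous _).mul (formOfCoeffs_isHomogeneous _)

theorem eq_zero_of_pow_X_dvd_of_pow_X_sub_one_dvd {φ : Polynomial ℂ} {t m n : ℕ}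
    (hdeg : φ.natDegree ≤ t) (h0 : Polynomial.X ^ m ∣ φ) (h1 : (Polynomial.X - 1) ^ n ∣ φ)
    (hmn : t < m + n) : φ = 0 := by
  have hco : IsCoprime ((Polynomial.X : Polynomial ℂ) ^ m) ((Polynomial.X - 1) ^ n) :=
    IsCoprime.pow ⟨1, -1, by ring⟩
  have hdvd := hco.mul_dvd h0 h1
  by_contra hφ
  have := Polynomial.natDegree_le_of_dvd hdvd hφ
  rw [Polynomial.natDegree_mul (pow_ne_zero _ Polynomial.X_ne_zero)
    (pow_ne_zero _ (by simpa using Polynomial.X_sub_C_ne_zero (1 : ℂ))), Polynomial.natDegree_pow,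
    Polynomial.natDegree_pow, Polynomial.natDegree_X, ← Polynomial.C_1,
    Polynomial.natDegree_X_sub_C] at this
  omega

theorem pow_mul_pow_mem {R : Type*} [CommRing R] [Algebra ℂ R] (J : Submodule ℂ R)
    (u z h : R) {i t a b : ℕ} (hab : a + b ≤ 2 * i + t + 1)
    (hu : ∀ k ≤ i + t, a ≤ k → u ^ k * z ^ (i + t - k) * h ∈ J)
    (hv : ∀ k ≤ i + t, b ≤ k → (u + z) ^ k * z ^ (i + t - k) * h ∈ J)
    (hz : ∀ k < i, u ^ k * z ^ (i + t - k) * h ∈ J) : u ^ i * z ^ t * h ∈ J := by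
  by_contra hmem
  obtain ⟨l, hl, hJ⟩ := Submodule.exists_le_ker_of_notMem hmem
  replace hJ : ∀ r ∈ J, l r = 0 := fun r hr => hJ hr
  set E := i + t with hE
  -- `φ u X` and `φ (u + z) (X - 1)` expand `s ↦ l ((u + s • z) ^ E * h)` around `0` and `1`
  let φ (v : R) (p : Polynomial ℂ) : Polynomial ℂ := ∑ k ∈ Finset.range (E + 1),
    Polynomial.C (l (v ^ k * z ^ (E - k) * h) * (E.choose k : ℂ)) * p ^ (E - k)
  have heval (v : R) (p : Polynomial ℂ) (s : ℂ) :
      (φ v p).eval s = l ((v + p.eval s • z) ^ E * h) := by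
    rw [add_pow, Finset.sum_mul, map_sum, Polynomial.eval_finsetSum]
    refine Finset.sum_congr rfl fun k _ => ?_
    have : v ^ k * (p.eval s • z) ^ (E - k) * (E.choose k : R) * h
        = ((E.choose k : ℂ) * p.eval s ^ (E - k)) • (v ^ k * z ^ (E - k) * h) := by
      simp only [Algebra.smul_def, map_mul, map_pow, map_natCast, mul_pow]
      ring
    rw [this, map_smul]
    simp
    ring
  have heq : φ u Polynomial.X = φ (u + z) (Polynomial.X - 1) := by
    refine Polynomial.funext fun s => ?_
    rw [heval, heval]
    congr 3
    simp [sub_smul]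
  have hdvd (v : R) (p : Polynomial ℂ) (c : ℕ)
      (hc : ∀ k ≤ E, c ≤ k → v ^ k * z ^ (E - k) * h ∈ J) : p ^ (E + 1 - c) ∣ φ v p := by
    refine Finset.dvd_sum fun k hk => ?_
    rw [Finset.mem_range] at hk
    rcases le_or_gt c k with hck | hck
    · rw [hJ _ (hc k (by omega) hck)]
      simp
    · exact Dvd.dvd.mul_left (pow_dvd_pow _ (by omega)) _
  have hcoeff (j : ℕ) (hj : j ≤ E) : (φ u Polynomial.X).coeff j
      = l (u ^ (E - j) * z ^ j * h) * (E.choose (E - j) : ℂ) := by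
    simp only [φ, Polynomial.finsetSum_coeff, Polynomial.coeff_C_mul, Polynomial.coeff_X_pow]
    rw [Finset.sum_eq_single (E - j)]
    · rw [if_pos (by omega), mul_one, show E - (E - j) = j by omega]
    · intro k hk hkj
      rw [Finset.mem_range] at hk
      rw [if_neg (by omega), mul_zero]
    · intro hk
      rw [Finset.mem_range] at hk
      omega
  have hzero : φ u Polynomial.X = 0 := by
    refine eq_zero_of_pow_X_dvd_of_pow_X_sub_one_dvd (t := t) ?_ (hdvd u _ a hu)
      (by rw [heq]; exact hdvd (u + z) _ b hv) (by omega)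
    refine Polynomial.natDegree_sum_le_of_forall_le _ _ fun k hk => ?_
    rw [Finset.mem_range] at hk
    rcases lt_or_ge k i with hki | hki
    · rw [hJ _ (hz k hki)]
      simp
    · exact (Polynomial.natDegree_C_mul_X_pow_le _ _).trans (by omega)
  have := hcoeff t (by omega)
  rw [hzero, Polynomial.coeff_zero, show E - t = i by omega] at this
  rcases mul_eq_zero.mp this.symm with h' | h'
  · exact hl h'
  · exact (Nat.choose_pos (show i ≤ E by omega)).ne' (by exact_mod_cast h')

/-- In every degree `D`, the forms in `B` together with the powers `u ^ (D / 2)`, for `u` in `U`,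
generate all forms of degree `D`. -/
def Generates (B U : Set (MvPolynomial (Fin 4) ℂ)) : Prop :=
  ∀ (J : Submodule ℂ (MvPolynomial (Fin 4) ℂ)) (D : ℕ),
    (∀ b ∈ B, ∀ k h, h.IsHomogeneous k → k + 1 = D → b * h ∈ J) →
    (∀ u ∈ U, ∀ k h, h.IsHomogeneous k → D / 2 + k = D → u ^ (D / 2) * h ∈ J) →
    ∀ f, f.IsHomogeneous D → f ∈ J

theorem Generates.mem_of_pairs {B U : Set (MvPolynomial (Fin 4) ℂ)} {z : MvPolynomial (Fin 4) ℂ}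
    (hz : z.IsHomogeneous 1) (hU : ∀ u ∈ U, u.IsHomogeneous 1) (hB : Generates (insert z B) U)
    (J : Submodule ℂ (MvPolynomial (Fin 4) ℂ)) (d : ℕ)
    (hJB : ∀ b ∈ B, ∀ k h, h.IsHomogeneous k → k + 1 = d → b * h ∈ J)
    (hJU : ∀ u ∈ U, ∃ a b, a + b ≤ d ∧
      (∀ k h, h.IsHomogeneous k → a + k = d → u ^ a * h ∈ J) ∧
      (∀ k h, h.IsHomogeneous k → b + k = d → (u + z) ^ b * h ∈ J))
    (f : MvPolynomial (Fin 4) ℂ) (hf : f.IsHomogeneous d) : f ∈ J := by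
  suffices H : ∀ D t, t + D = d → ∀ f : MvPolynomial (Fin 4) ℂ, f.IsHomogeneous D →
      z ^ t * f ∈ J by simpa using H d 0 (by omega) f hf
  intro D
  induction D using Nat.strong_induction_on with
  | _ D ih =>
  intro t ht f hf
  refine hB (J.comap (LinearMap.mulLeft ℂ (z ^ t))) D ?_ ?_ f hf
  · intro b hb k h hh hk
    rw [Submodule.mem_comap, LinearMap.mulLeft_apply]
    rcases hb with rfl | hb
    · rw [← mul_assoc, ← pow_succ]
      exact ih k (by omega) (t + 1) (by omega) h hh
    · rw [mul_left_comm]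
      exact hJB b hb _ _ ((hz.pow t).mul hh) (by omega)
  · intro u hu k h hh hk
    obtain ⟨a, b, hab, ha, hb⟩ := hJU u hu
    have hu1 := hU u hu
    rw [Submodule.mem_comap, LinearMap.mulLeft_apply, mul_left_comm, ← mul_assoc]
    refine pow_mul_pow_mem J u z h (a := a) (b := b) (by omega) ?_ ?_ ?_
    · intro j hj haj
      rw [← Nat.add_sub_cancel' haj, pow_add, mul_assoc, mul_assoc]
      exact ha _ _ ((hu1.pow _).mul ((hz.pow _).mul hh)) (by omega)
    · intro j hj hbj
      rw [← Nat.add_sub_cancel' hbj, pow_add, mul_assoc, mul_assoc]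
      exact hb _ _ (((hu1.add hz).pow _).mul ((hz.pow _).mul hh)) (by omega)
    · intro j hj
      rw [show D / 2 + t - j = (t + 1) + (D / 2 - j - 1) by omega, pow_add, mul_left_comm,
        mul_assoc]
      exact ih (D - 1) (by omega) (t + 1) (by omega) _
        (by convert ((hu1.pow j).mul (hz.pow (D / 2 - j - 1))).mul hh using 1; omega)

theorem Generates.of_insert {B U : Set (MvPolynomial (Fin 4) ℂ)} {z : MvPolynomial (Fin 4) ℂ}
    (hz : z.IsHomogeneous 1) (hU : ∀ u ∈ U, u.IsHomogeneous 1) (hB : Generates (insert z B) U) :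
    Generates B (U ∪ (· + z) '' U) := by
  intro J D hJB hJU f hf
  refine hB.mem_of_pairs hz hU J D hJB (fun u hu => ⟨D / 2, D / 2, by omega, ?_, ?_⟩) f hf
  · exact hJU u (.inl hu)
  · exact hJU (u + z) (.inr ⟨u, hu, rfl⟩)

theorem generates_X_zero : Generates {X 1, X 2, X 3} {X 0} := by
  intro J D hJB hJU f hf
  rw [f.as_sum]
  refine Submodule.sum_mem _ fun m hm => ?_
  have hdeg : m.degree = D := by
    rw [Finsupp.degree_eq_weight_one]; exact hf (mem_support_iff.mp hm)
  have hcase (i : Fin 4) (hi : X i ∈ ({X 1, X 2, X 3} : Set (MvPolynomial (Fin 4) ℂ)))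
      (hmi : m i ≠ 0) : monomial m (coeff m f) ∈ J := by
    obtain ⟨n, rfl⟩ : ∃ n, m = Finsupp.single i 1 + n :=
      ⟨m - Finsupp.single i 1, (add_tsub_cancel_of_le (by simpa [Nat.one_le_iff_ne_zero])).symm⟩
    rw [← one_mul (coeff _ f), ← monomial_mul]
    refine hJB _ hi n.degree _ (isHomogeneous_monomial _ rfl) ?_
    rw [← hdeg, map_add, Finsupp.degree_single, add_comm]
  by_cases h1 : m 1 = 0
  swap; · exact hcase 1 (by simp) h1
  by_cases h2 : m 2 = 0
  swap; · exact hcase 2 (by simp) h2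
  by_cases h3 : m 3 = 0
  swap; · exact hcase 3 (by simp) h3
  have hm0 : m = Finsupp.single 0 (D / 2) + Finsupp.single 0 (D - D / 2) := by
    rw [← Finsupp.single_add, Nat.add_sub_cancel' (Nat.div_le_self _ _)]
    have : m.degree = m 0 := by
      rw [Finsupp.degree_eq_sum, Fin.sum_univ_four, h1, h2, h3, add_zero, add_zero, add_zero]
    ext i
    fin_cases i <;> simp [h1, h2, h3, ← hdeg, this]
  have := hJU (X 0) rfl (D - D / 2) (monomial (Finsupp.single 0 (D - D / 2)) (coeff m f))
    (isHomogeneous_monomial _ (Finsupp.degree_single ..)) (by omega)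
  rwa [X_pow_eq_monomial, monomial_mul, ← hm0, one_mul] at this

theorem sum_perm_four {R : Type*} [AddCommMonoid R] (F : Equiv.Perm (Fin 4) → R) :
    ∑ p, F p = ∑ a : Fin 4, ∑ b : Fin 3, ∑ c : Fin 2,
      F (Equiv.Perm.decomposeFin.symm (a, Equiv.Perm.decomposeFin.symm
        (b, Equiv.Perm.decomposeFin.symm (c, 1)))) := by
  rw [← Equiv.Perm.decomposeFin.symm.sum_comp, Fintype.sum_prod_type]
  refine Finset.sum_congr rfl fun a _ => ?_
  rw [← Equiv.Perm.decomposeFin.symm.sum_comp, Fintype.sum_prod_type]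
  refine Finset.sum_congr rfl fun b _ => ?_
  rw [← Equiv.Perm.decomposeFin.symm.sum_comp, Fintype.sum_prod_type]
  refine Finset.sum_congr rfl fun c _ => ?_
  simp

theorem pfaff_four_of_isSkew {σ : Type*}
    (M : Matrix (Fin (2 * 2)) (Fin (2 * 2)) (MvPolynomial σ ℂ)) (hM : IsSkew M) :
    pfaff M = M 0 1 * M 2 3 - M 0 2 * M 1 3 + M 0 3 * M 1 2 := by
  have h10 := hM 0 1
  have h20 := hM 0 2
  have h30 := hM 0 3
  have h21 := hM 1 2
  have h31 := hM 1 3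
  have h32 := hM 2 3
  have key (x y : MvPolynomial σ ℂ) (h : x = (8 : ℂ) • y) :
      (((2^2 * (2).factorial : ℕ) : ℂ)⁻¹) • x = y := by
    rw [h, smul_smul]; norm_num [Nat.factorial]
  refine key _ _ ?_
  have h8 : (8 : ℂ) • (M 0 1 * M 2 3 - M 0 2 * M 1 3 + M 0 3 * M 1 2) =
      8 * (M 0 1 * M 2 3 - M 0 2 * M 1 3 + M 0 3 * M 1 2) := by
    rw [Algebra.smul_def, map_ofNat]
  rw [h8]
  refine (sum_perm_four _).trans ?_
  have e2 (a : Fin 4) (π : Equiv.Perm (Fin 3)) :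
      Equiv.Perm.decomposeFin.symm (a, π) 2 = Equiv.swap 0 a (π 1).succ :=
    Equiv.Perm.decomposeFin_symm_apply_succ π a 1
  have e3 (a : Fin 4) (π : Equiv.Perm (Fin 3)) :
      Equiv.Perm.decomposeFin.symm (a, π) 3 = Equiv.swap 0 a (π 2).succ :=
    Equiv.Perm.decomposeFin_symm_apply_succ π a 2
  have e2' (a : Fin 3) (π : Equiv.Perm (Fin 2)) :
      Equiv.Perm.decomposeFin.symm (a, π) 2 = Equiv.swap 0 a (π 1).succ :=
    Equiv.Perm.decomposeFin_symm_apply_succ π a 1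
  simp [Fin.sum_univ_succ, Fin.prod_univ_succ, Equiv.Perm.decomposeFin.symm_sign,
    Equiv.swap_apply_def, e2, e3, e2', h10, h20, h30, h21, h31, h32]
  ring

theorem generates_X_three : Generates {X 3} {X 0, X 0 + X 1, X 0 + X 2, X 0 + X 1 + X 2} := by
  have hX (i : Fin 4) : (X i : MvPolynomial (Fin 4) ℂ).IsHomogeneous 1 := isHomogeneous_X _ _
  have h1 := generates_X_zero.of_insert (hX 1) (by rintro _ rfl; exact hX 0)
  have h2 := h1.of_insert (hX 2) (by
    rintro _ (rfl | ⟨_, rfl, rfl⟩)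
    · exact hX 0
    · exact (hX 0).add (hX 1))
  convert h2 using 1
  ext v
  simp only [Set.mem_insert_iff, Set.mem_singleton_iff, Set.image_singleton, Set.mem_union,
    Set.image_union]
  tauto

theorem exists_tangent_decomposition {d : ℕ} {e e' : Fin 4 → ℕ} (he : ∀ i, e i + e' i = d) :
    ∃ f g : Fin 4 → MvPolynomial (Fin 4) ℂ, (∀ i, (f i).IsHomogeneous (e i)) ∧
      (∀ i, (g i).IsHomogeneous (e' i)) ∧ ∀ F : MvPolynomial (Fin 4) ℂ, F.IsHomogeneous d →
      ∃ h k : Fin 4 → MvPolynomial (Fin 4) ℂ, (∀ i, (h i).IsHomogeneous (e i)) ∧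
        (∀ i, (k i).IsHomogeneous (e' i)) ∧ F = ∑ i, (f i * k i + h i * g i) := by
  have hX (i : Fin 4) : (X i : MvPolynomial (Fin 4) ℂ).IsHomogeneous 1 := isHomogeneous_X _ _
  let u : Fin 4 → MvPolynomial (Fin 4) ℂ := ![X 0, X 0 + X 1, X 0 + X 2, X 0 + X 1 + X 2]
  have hu (i : Fin 4) : (u i).IsHomogeneous 1 := by
    fin_cases i
    exacts [hX 0, (hX 0).add (hX 1), (hX 0).add (hX 2), ((hX 0).add (hX 1)).add (hX 2)]
  have hrange : Set.range u = {X 0, X 0 + X 1, X 0 + X 2, X 0 + X 1 + X 2} := by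
    simp [u, Matrix.range_cons, Set.insert_def, Set.union_def]
  have hgen : Generates (insert (X 3) ∅) (Set.range u) := by
    rw [hrange, insert_empty_eq]
    exact generates_X_three
  refine ⟨fun i => u i ^ e i, fun i => (u i + X 3) ^ e' i, fun i => ?_, fun i => ?_, ?_⟩
  · simpa using (hu i).pow (e i)
  · simpa using ((hu i).add (hX 3)).pow (e' i)
  let J : Submodule ℂ (MvPolynomial (Fin 4) ℂ) :=
    { carrier := {F | ∃ h k : Fin 4 → MvPolynomial (Fin 4) ℂ, (∀ i, (h i).IsHomogeneous (e i)) ∧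
        (∀ i, (k i).IsHomogeneous (e' i)) ∧
        F = ∑ i, (u i ^ e i * k i + h i * (u i + X 3) ^ e' i)}
      zero_mem' := ⟨0, 0, fun i => isHomogeneous_zero _ _ _, fun i => isHomogeneous_zero _ _ _,
        by simp⟩
      add_mem' := by
        rintro _ _ ⟨h, k, hh, hk, rfl⟩ ⟨h', k', hh', hk', rfl⟩
        refine ⟨h + h', k + k', fun i => (hh i).add (hh' i), fun i => (hk i).add (hk' i), ?_⟩
        rw [← Finset.sum_add_distrib]
        refine Finset.sum_congr rfl fun i _ => ?_
        simp only [Pi.add_apply]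
        ring
      smul_mem' := by
        rintro c _ ⟨h, k, hh, hk, rfl⟩
        refine ⟨fun i => C c * h i, fun i => C c * k i, fun i => (hh i).C_mul c,
          fun i => (hk i).C_mul c, ?_⟩
        rw [smul_eq_C_mul, Finset.mul_sum]
        refine Finset.sum_congr rfl fun i _ => ?_
        ring }
  have hsingle {n : Fin 4 → ℕ} {i : Fin 4} {q : MvPolynomial (Fin 4) ℂ}
      (hq : q.IsHomogeneous (n i)) (j : Fin 4) :
      ((Pi.single i q : Fin 4 → MvPolynomial (Fin 4) ℂ) j).IsHomogeneous (n j) := by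
    rcases eq_or_ne j i with rfl | hji
    · rwa [Pi.single_eq_same]
    · rw [Pi.single_eq_of_ne hji]
      exact isHomogeneous_zero _ _ _
  refine hgen.mem_of_pairs (hX 3) (by rintro _ ⟨i, rfl⟩; exact hu i) J d (by simp) ?_
  rintro _ ⟨i, rfl⟩
  have hi := he i
  refine ⟨e i, e' i, hi.le, fun k q hq hk => ?_, fun k q hq hk => ?_⟩
  · obtain rfl : k = e' i := by omega
    refine ⟨0, Pi.single i q, fun j => isHomogeneous_zero _ _ _, hsingle hq, ?_⟩
    rw [Finset.sum_eq_single i (fun j _ hj => by simp [hj]) (by simp)]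
    simp
  · obtain rfl : k = e i := by omega
    refine ⟨Pi.single i q, 0, hsingle hq, fun j => isHomogeneous_zero _ _ _, ?_⟩
    rw [Finset.sum_eq_single i (fun j _ hj => by simp [hj]) (by simp)]
    simp [mul_comm]

/-- The skew-symmetric matrix whose entries above the diagonal are `a, b, c, p, q, r`, row by
row. -/
def skewFour {R : Type*} [Ring R] (a b c p q r : R) : Matrix (Fin (2 * 2)) (Fin (2 * 2)) R :=
  !![0, a, b, c; -a, 0, p, q; -b, -p, 0, r; -c, -q, -r, 0]

theorem skewFour_isSkew {R : Type*} [Ring R] (a b c p q r : R) :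
    IsSkew (skewFour a b c p q r) := by
  intro i j
  fin_cases i <;> fin_cases j <;> simp [skewFour]

theorem pfaff_skewFour {σ : Type*} (a b c p q r : MvPolynomial σ ℂ) :
    pfaff (skewFour a b c p q r) = a * r - b * q + c * p := by
  rw [pfaff_four_of_isSkew _ (skewFour_isSkew a b c p q r)]
  simp [skewFour]

theorem skewFour_degMat {σ : Type*} {A : Matrix (Fin (2 * 2)) (Fin (2 * 2)) ℕ} (hA : A.IsSymm)
    {a b c p q r : MvPolynomial σ ℂ} (ha : a.IsHomogeneous (A 0 1)) (hb : b.IsHomogeneous (A 0 2))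
    (hc : c.IsHomogeneous (A 0 3)) (hp : p.IsHomogeneous (A 1 2)) (hq : q.IsHomogeneous (A 1 3))
    (hr : r.IsHomogeneous (A 2 3)) : DegMat (skewFour a b c p q r) A := by
  have h0 (n : ℕ) : (0 : MvPolynomial σ ℂ).IsHomogeneous n := isHomogeneous_zero _ _ _
  intro i j
  fin_cases i <;> fin_cases j
  exacts [h0 _, ha, hb, hc, hA.apply 0 1 ▸ ha.neg, h0 _, hp, hq, hA.apply 0 2 ▸ hb.neg,
    hA.apply 1 2 ▸ hp.neg, h0 _, hr, hA.apply 0 3 ▸ hc.neg, hA.apply 1 3 ▸ hq.neg,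
    hA.apply 2 3 ▸ hr.neg, h0 _]

/-- Let `A` be a `4 × 4` symmetric homogeneous matrix of non-negative
integers with trace `2d`. Then a general form of degree `d` in four variables is the sum
of two Pfaffians of skew-symmetric `4 × 4` matrices of forms with degree matrix `A`.
Genericity is expressed by a nonzero polynomial `P` in the coefficients of the form. -/
theorem general_quaternary_form_is_sum_of_two_4x4_pfaffians
    (d : ℕ)
    (A : Matrix (Fin (2*2)) (Fin (2*2)) ℕ) (hsym : A.IsSymm) (hhom : HomogMat A)
    (htr : Matrix.trace A = 2 * d) :
    ∃ P : MvPolynomial ((Fin 4) →₀ ℕ) ℂ, P ≠ 0 ∧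
      (∃ F : MvPolynomial (Fin 4) ℂ, F.IsHomogeneous d ∧
        MvPolynomial.eval (fun m => MvPolynomial.coeff m F) P ≠ 0) ∧
      ∀ F : MvPolynomial (Fin 4) ℂ, F.IsHomogeneous d →
        MvPolynomial.eval (fun m => MvPolynomial.coeff m F) P ≠ 0 →
        ∃ M₁ M₂ : Matrix (Fin (2*2)) (Fin (2*2)) (MvPolynomial (Fin 4) ℂ),
          IsSkew M₁ ∧ IsSkew M₂ ∧ DegMat M₁ A ∧ DegMat M₂ A ∧
          F = pfaff M₁ + pfaff M₂ := by
  have hdeg : A 0 1 + A 2 3 = d ∧ A 0 2 + A 1 3 = d ∧ A 0 3 + A 1 2 = d := by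
    have htr' : A 0 0 + A 1 1 + A 2 2 + A 3 3 = 2 * d := by
      rw [← htr]
      exact (Fin.sum_univ_four fun i => A i i).symm
    have h01 := hhom 0 0 1 1
    have h23 := hhom 2 2 3 3
    have h02 := hhom 0 1 2 3
    have h03 := hhom 0 1 3 2
    have s10 := hsym.apply 0 1
    have s32 := hsym.apply 2 3
    have s21 := hsym.apply 1 2
    have s31 := hsym.apply 1 3
    omega
  obtain ⟨hd1, hd2, hd3⟩ := hdeg
  have he (i : Fin 4) : (![A 0 1, A 0 2, A 0 3, A 0 1] : Fin 4 → ℕ) i +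
      (![A 2 3, A 1 3, A 1 2, A 2 3] : Fin 4 → ℕ) i = d := by
    fin_cases i
    exacts [hd1, hd2, hd3, hd1]
  obtain ⟨f, g, hf, hg, htangent⟩ := exists_tangent_decomposition he
  obtain ⟨P, hP, hPF, hsum⟩ := exists_eval_ne_zero_sum_mul he hf hg htangent
  refine ⟨P, hP, hPF, fun F hF hne => ?_⟩
  obtain ⟨h, k, hh, hk, rfl⟩ := hsum F hF hne
  have h0 (n : ℕ) : (0 : MvPolynomial (Fin 4) ℂ).IsHomogeneous n := isHomogeneous_zero _ _ _
  refine ⟨skewFour (h 0) (h 1) (h 2) (k 2) (-k 1) (k 0), skewFour (h 3) 0 0 0 0 (k 3),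
    skewFour_isSkew _ _ _ _ _ _, skewFour_isSkew _ _ _ _ _ _, ?_, ?_, ?_⟩
  · exact skewFour_degMat hsym (hh 0) (hh 1) (hh 2) (hk 2) (hk 1).neg (hk 0)
  · exact skewFour_degMat hsym (hh 3) (h0 _) (h0 _) (h0 _) (h0 _) (hk 3)
  · rw [pfaff_skewFour, pfaff_skewFour, Fin.sum_univ_four]
    ring
end
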